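/- Let n, n', m, m' ∈ ℕ and let F : 𝓢(ℝ^n) → 𝓢(ℝ^m) and F' : 𝓢(ℝ^{n'}) → 𝓢(ℝ^{m'}) be continuous linear maps. Then there exists a unique continuous linear map T : 𝓢(ℝ^{n+n'}) → 𝓢(ℝ^{m+m'}) such that T(f ⊠ f') = F(f) ⊠ F'(f') for all f ∈ 𝓢(ℝ^n), f' ∈ 𝓢(ℝ^{n'}); furthermore T = (F ⊗ id_{m'}) ∘ (id_n ⊗ F') = (id_m ⊗ F') ∘ (F ⊗ id_{n'}), i.e., the two compositions of augmentations acting on disjoint groups of variables coincide. -/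

import Mathlib

noncomputable section

/-- `ℝ^d`. -/
abbrev Euc (d : ℕ) : Type := EuclideanSpace ℝ (Fin d)

/-- `T` is the tensor product `F ⊗ G`, i.e. the (unique) continuous linear operator with
`T (f ⊠ g) = F f ⊠ G g` on tensor products (`f ⊠ g` being `(x, y) ↦ f x * g y`). -/
def TChar {V₁ V₂ W₁ W₂ : Type*}
    [NormedAddCommGroup V₁] [NormedSpace ℝ V₁] [NormedAddCommGroup V₂] [NormedSpace ℝ V₂]
    [NormedAddCommGroup W₁] [NormedSpace ℝ W₁] [NormedAddCommGroup W₂] [NormedSpace ℝ W₂]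
    (F : SchwartzMap V₁ ℂ →L[ℂ] SchwartzMap W₁ ℂ)
    (G : SchwartzMap V₂ ℂ →L[ℂ] SchwartzMap W₂ ℂ)
    (T : SchwartzMap (V₁ × V₂) ℂ →L[ℂ] SchwartzMap (W₁ × W₂) ℂ) : Prop :=
  ∀ (f : SchwartzMap V₁ ℂ) (g : SchwartzMap V₂ ℂ) (w : SchwartzMap (V₁ × V₂) ℂ),
    (∀ (x : V₁) (y : V₂), w (x, y) = f x * g y) →
    ∀ (x : W₁) (y : W₂), T w (x, y) = F f x * G g y

namespace SchwartzTensor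

open scoped SchwartzMap LineDeriv ContDiff BoundedContinuousFunction
open MeasureTheory Filter Topology

section Calculus

variable {E F : Type*} [NormedAddCommGroup E] [NormedSpace ℝ E]
  [NormedAddCommGroup F] [NormedSpace ℝ F]

/-- The coordinate functionals of a fixed basis of a finite-dimensional space. -/
def coordCLM (E : Type*) [NormedAddCommGroup E] [NormedSpace ℝ E] [FiniteDimensional ℝ E]
    (i : Fin (Module.finrank ℝ E)) : E →L[ℝ] ℝ :=
  LinearMap.toContinuousLinearMap ((Module.finBasis ℝ E).coord i)

lemma sum_coordCLM_smul [FiniteDimensional ℝ E] (x : E) :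
    ∑ i, coordCLM E i x • Module.finBasis ℝ E i = x :=
  (Module.finBasis ℝ E).sum_repr x

lemma sum_coordCLM_smulRight [FiniteDimensional ℝ E] (L : E →L[ℝ] F) :
    ∑ i, (coordCLM E i).smulRight (L (Module.finBasis ℝ E i)) = L := by
  ext x
  conv_rhs => rw [← sum_coordCLM_smul x, map_sum]
  simp

lemma norm_iteratedFDeriv_succ_le_sum {ι : Type*} [Fintype ι] {G : E → F} {c : ι → E →L[ℝ] ℝ}
    {H : ι → E → F} (hG : ∀ x, HasFDerivAt G (∑ i, (c i).smulRight (H i x)) x)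
    (hH : ∀ i, ContDiff ℝ ∞ (H i)) (l : ℕ) (x : E) :
    ‖iteratedFDeriv ℝ (l + 1) G x‖ ≤ ∑ i, ‖c i‖ * ‖iteratedFDeriv ℝ l (H i) x‖ := by
  have hl : (l : WithTop ℕ∞) ≤ ∞ := by exact_mod_cast le_top
  have hfd : fderiv ℝ G = ∑ i, (ContinuousLinearMap.smulRightL ℝ E F (c i)) ∘ H i := by
    ext1 x
    rw [(hG x).fderiv]
    simp
  rw [← norm_iteratedFDeriv_fderiv, hfd,
    show iteratedFDeriv ℝ l (∑ i, ContinuousLinearMap.smulRightL ℝ E F (c i) ∘ H i) = _ from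
      (congrArg _ (Finset.sum_fn _ _)).trans <| iteratedFDeriv_sum fun i _ ↦
        (ContinuousLinearMap.contDiff _).comp ((hH i).of_le hl), Finset.sum_apply]
  refine (norm_sum_le _ _).trans (Finset.sum_le_sum fun i _ ↦ ?_)
  refine (ContinuousLinearMap.norm_iteratedFDeriv_comp_left _ (hH i).contDiffAt hl).trans ?_
  gcongr
  exact ContinuousLinearMap.opNorm_le_bound _ (norm_nonneg _) fun f ↦ by simp

/-- A family of functions whose derivatives are combinations of members of the family consists of
smooth functions. -/
lemma contDiff_of_closed_family {A ι : Type*} [Fintype ι] {G : A → E → F} {c : ι → E →L[ℝ] ℝ}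
    {d : ι → A → A} (hG : ∀ a x, HasFDerivAt (G a) (∑ i, (c i).smulRight (G (d i a) x)) x)
    (a : A) : ContDiff ℝ ∞ (G a) := by
  rw [contDiff_infty]
  intro n
  induction n generalizing a with
  | zero =>
    exact contDiff_zero.2 (continuous_iff_continuousAt.2 fun x ↦ (hG a x).continuousAt)
  | succ n ih =>
    push_cast
    rw [contDiff_succ_iff_hasFDerivAt (n := n)]
    refine ⟨_, ?_, hG a⟩
    exact ContDiff.sum fun i _ ↦
      (ContinuousLinearMap.smulRightL ℝ E F (c i)).contDiff.comp (ih (d i a))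

end Calculus

section Translation

variable {E F : Type*} [NormedAddCommGroup E] [NormedSpace ℝ E]
  [NormedAddCommGroup F] [NormedSpace ℝ F]

lemma exists_seminorm_succ_le [FiniteDimensional ℝ E] : ∃ C, 0 ≤ C ∧ ∀ (k l : ℕ) (f : 𝓢(E, ℂ)),
    SchwartzMap.seminorm ℂ k (l + 1) f ≤
      C * ∑ i, SchwartzMap.seminorm ℂ k l (∂_{Module.finBasis ℝ E i} f) := by
  refine ⟨∑ i, ‖coordCLM E i‖, by positivity, fun k l f ↦ ?_⟩
  refine SchwartzMap.seminorm_le_bound ℂ k (l + 1) f (by positivity) fun x ↦ ?_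
  have hf : ∀ x, HasFDerivAt f (∑ i, (coordCLM E i).smulRight
      ((∂_{Module.finBasis ℝ E i} f) x)) x := fun x ↦ by
    simp only [SchwartzMap.lineDerivOp_apply_eq_fderiv, sum_coordCLM_smulRight]
    exact f.hasFDerivAt x
  grw [norm_iteratedFDeriv_succ_le_sum hf (fun i ↦ SchwartzMap.smooth _ ⊤) l x,
    Finset.mul_sum, Finset.sum_mul]
  refine Finset.sum_le_sum fun i _ ↦ ?_
  rw [mul_left_comm]
  gcongr
  exact (SchwartzMap.le_seminorm ℂ k l _ x).trans (Finset.single_le_sum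
    (f := fun i ↦ SchwartzMap.seminorm ℂ k l (∂_{Module.finBasis ℝ E i} f))
    (fun i _ ↦ apply_nonneg _ _) (Finset.mem_univ i))

lemma exists_pow_mul_norm_add_sub_le (w : 𝓢(E, F)) (k : ℕ) : ∃ C, 0 ≤ C ∧
    ∀ h x : E, ‖h‖ ≤ 1 → ‖x‖ ^ k * ‖w (x + h) - w x‖ ≤ C * ‖h‖ := by
  obtain ⟨M, hM⟩ : ∃ M, ∀ x, (1 + ‖x‖) ^ k * ‖fderiv ℝ w x‖ ≤ M := by
    refine ⟨2 ^ k * (Finset.Iic (k, 1)).sup (fun m ↦ SchwartzMap.seminorm ℝ m.1 m.2) w,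
      fun x ↦ ?_⟩
    rw [← norm_iteratedFDeriv_one]
    exact SchwartzMap.one_add_le_sup_seminorm_apply (𝕜 := ℝ) (m := (k, 1)) le_rfl le_rfl w x
  refine ⟨M, le_trans (by positivity) (hM 0), fun h x hh ↦ ?_⟩
  have hd : ∀ y ∈ segment ℝ x (x + h), HasFDerivWithinAt (fun y ↦ ‖x‖ ^ k • w y)
      (‖x‖ ^ k • fderiv ℝ w y) (segment ℝ x (x + h)) y :=
    fun y _ ↦ ((w.hasFDerivAt y).const_smul (‖x‖ ^ k)).hasFDerivWithinAt
  have hb : ∀ y ∈ segment ℝ x (x + h), ‖‖x‖ ^ k • fderiv ℝ w y‖ ≤ M := fun y hy ↦ by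
    have hxy : ‖x‖ ≤ 1 + ‖y‖ := by
      have h1 : ‖y - x‖ ≤ ‖h‖ := by simpa using norm_sub_le_of_mem_segment hy
      have h2 := norm_sub_norm_le x y
      rw [norm_sub_rev] at h2
      linarith
    rw [norm_smul, norm_pow, norm_norm]
    grw [hxy]
    exact hM y
  have := (convex_segment x (x + h)).norm_image_sub_le_of_norm_hasFDerivWithin_le hd hb
    (left_mem_segment ℝ x (x + h)) (right_mem_segment ℝ x (x + h))
  simpa [← smul_sub, norm_smul] using this

lemma exists_pow_mul_norm_add_sub_sub_le (w : 𝓢(E, F)) (k : ℕ) : ∃ C, 0 ≤ C ∧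
    ∀ h x : E, ‖h‖ ≤ 1 →
      ‖x‖ ^ k * ‖w (x + h) - w x - fderiv ℝ w x h‖ ≤ C * ‖h‖ ^ 2 := by
  obtain ⟨C, hC, hw⟩ := exists_pow_mul_norm_add_sub_le (SchwartzMap.fderivCLM ℝ E F w) k
  refine ⟨C, hC, fun h x hh ↦ ?_⟩
  have hd : ∀ y ∈ segment ℝ x (x + h), HasFDerivWithinAt (fun y ↦ ‖x‖ ^ k • w y)
      (‖x‖ ^ k • fderiv ℝ w y) (segment ℝ x (x + h)) y :=
    fun y _ ↦ ((w.hasFDerivAt y).const_smul (‖x‖ ^ k)).hasFDerivWithinAt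
  have hb : ∀ y ∈ segment ℝ x (x + h),
      ‖‖x‖ ^ k • fderiv ℝ w y - ‖x‖ ^ k • fderiv ℝ w x‖ ≤ C * ‖h‖ := fun y hy ↦ by
    have h1 : ‖y - x‖ ≤ ‖h‖ := by simpa using norm_sub_le_of_mem_segment hy
    have := hw (y - x) x (h1.trans hh)
    rw [← smul_sub, norm_smul, norm_pow, norm_norm]
    grw [← h1]
    simpa using this
  have := (convex_segment x (x + h)).norm_image_sub_le_of_norm_hasFDerivWithin_le' hd hb
    (left_mem_segment ℝ x (x + h)) (right_mem_segment ℝ x (x + h))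
  simpa [← smul_sub, norm_smul, mul_assoc, sq] using this

/-- The translate `x ↦ w (x + h)` of a Schwartz function. -/
abbrev translate (h : E) : 𝓢(E, ℂ) →L[ℂ] 𝓢(E, ℂ) := SchwartzMap.compSubConstCLM ℂ (-h)

lemma lineDerivOp_translate (v h : E) (w : 𝓢(E, ℂ)) :
    ∂_{v} (translate h w) = translate h (∂_{v} w) := by
  ext x
  simp only [SchwartzMap.lineDerivOp_apply_eq_fderiv, SchwartzMap.compSubConstCLM_apply]
  rw [show ⇑(translate h w) = fun x ↦ w (x - -h) from
    funext fun x ↦ SchwartzMap.compSubConstCLM_apply w _ x, fderiv_comp_sub]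

lemma lineDerivOp_comm (v v' : E) (w : 𝓢(E, ℂ)) : ∂_{v} (∂_{v'} w) = ∂_{v'} (∂_{v} w) := by
  have key : ∀ (v v' : E) x, (∂_{v} (∂_{v'} w)) x = fderiv ℝ (fderiv ℝ w) x v v' := by
    intro v v' x
    rw [SchwartzMap.lineDerivOp_apply_eq_fderiv]
    have : ⇑(∂_{v'} w : 𝓢(E, ℂ)) = fun x ↦ fderiv ℝ w x v' :=
      funext fun x ↦ SchwartzMap.lineDerivOp_apply_eq_fderiv v' w x
    have hd : DifferentiableAt ℝ (fderiv ℝ w) x :=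
      (SchwartzMap.fderivCLM ℝ E ℂ w).differentiableAt
    rw [this, fderiv_clm_apply hd (differentiableAt_const _)]
    simp
  ext x
  rw [key, key]
  exact ((w.contDiffAt ⊤).isSymmSndFDerivAt
    (by simpa using WithTop.coe_le_coe.2 (le_top (a := (2 : ℕ∞))))) v v'

lemma exists_seminorm_translate_sub_sub_le [FiniteDimensional ℝ E] (k l : ℕ) (w : 𝓢(E, ℂ)) :
    ∃ C, 0 ≤ C ∧ ∀ h : E, ‖h‖ ≤ 1 →
      SchwartzMap.seminorm ℂ k l (translate h w - w - ∂_{h} w) ≤ C * ‖h‖ ^ 2 := by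
  induction l generalizing w with
  | zero =>
    obtain ⟨C, hC, hw⟩ := exists_pow_mul_norm_add_sub_sub_le w k
    refine ⟨C, hC, fun h hh ↦ SchwartzMap.seminorm_le_bound _ _ _ _ (by positivity) fun x ↦ ?_⟩
    simpa [SchwartzMap.compSubConstCLM_apply, SchwartzMap.lineDerivOp_apply_eq_fderiv]
      using hw h x hh
  | succ l ih =>
    obtain ⟨C₀, hC₀, hs⟩ := exists_seminorm_succ_le (E := E)
    choose C hC hw using fun i ↦ ih (∂_{Module.finBasis ℝ E i} w)
    refine ⟨C₀ * ∑ i, C i, mul_nonneg hC₀ (Finset.sum_nonneg fun i _ ↦ hC i), fun h hh ↦ ?_⟩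
    grw [hs, mul_assoc, Finset.sum_mul]
    gcongr with i
    refine le_trans (le_of_eq ?_) (hw i h hh)
    congr 1
    rw [← lineDerivOp_translate, lineDerivOp_comm h]
    simp only [← LineDeriv.lineDerivOpCLM_apply (R := ℂ), map_sub]

end Translation

section Slices

variable {E V R B : Type*} [NormedAddCommGroup E] [NormedSpace ℝ E]
  [NormedAddCommGroup V] [NormedSpace ℝ V] [NormedAddCommGroup R] [NormedSpace ℝ R]
  [NormedAddCommGroup B] [NormedSpace ℂ B]

lemma exists_le_sum_seminorm {q : Seminorm ℂ 𝓢(E, ℂ)} (hq : Continuous q) :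
    ∃ (s : Finset (ℕ × ℕ)) (C : ℝ), 0 ≤ C ∧
      ∀ f, q f ≤ C * ∑ a ∈ s, SchwartzMap.seminorm ℂ a.1 a.2 f := by
  obtain ⟨s, C, -, h⟩ := Seminorm.bound_of_continuous (schwartz_withSeminorms ℂ E ℂ) q hq
  refine ⟨s, C, C.2, fun f ↦ (h f).trans ?_⟩
  have := Seminorm.le_def.1 (Seminorm.finset_sup_le_sum (schwartzSeminormFamily ℂ E ℂ) s) f
  simp only [smul_apply, NNReal.smul_def, smul_eq_mul]
  gcongr
  simpa [sum_apply, schwartzSeminormFamily] using this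

lemma exists_norm_le_sum_seminorm (v : 𝓢(E, ℂ) →L[ℂ] B) :
    ∃ (s : Finset (ℕ × ℕ)) (C : ℝ), 0 ≤ C ∧
      ∀ f, ‖v f‖ ≤ C * ∑ a ∈ s, SchwartzMap.seminorm ℂ a.1 a.2 f :=
  exists_le_sum_seminorm (q := (normSeminorm ℂ B).comp v.toLinearMap) v.continuous.norm

lemma hasFDerivAt_translate [FiniteDimensional ℝ E] (v : 𝓢(E, ℂ) →L[ℂ] B) (w : 𝓢(E, ℂ)) :
    HasFDerivAt (fun h ↦ v (translate h w))
      (∑ i, (coordCLM E i).smulRight (v (∂_{Module.finBasis ℝ E i} w))) 0 := by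
  obtain ⟨s, C, hC, hv⟩ := exists_norm_le_sum_seminorm v
  choose K hK hw using fun a : ℕ × ℕ ↦ exists_seminorm_translate_sub_sub_le a.1 a.2 w
  rw [hasFDerivAt_iff_isLittleO_nhds_zero]
  refine Asymptotics.IsBigO.trans_isLittleO (g := fun h : E ↦ ‖h‖ ^ 2) ?_ ?_
  · refine Asymptotics.IsBigO.of_bound (C * ∑ a ∈ s, K a) ?_
    filter_upwards [Metric.closedBall_mem_nhds (0 : E) one_pos] with h hh
    rw [mem_closedBall_zero_iff] at hh
    have hl : (∑ i, (coordCLM E i).smulRight (v (∂_{Module.finBasis ℝ E i} w))) h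
        = v (∂_{h} w) := by
      conv_rhs => rw [← sum_coordCLM_smul h, LineDeriv.lineDerivOp_left_sum]
      simp only [LineDeriv.lineDerivOp_left_smul, map_sum, sum_apply,
        ContinuousLinearMap.smulRight_apply]
      exact Finset.sum_congr rfl fun i _ ↦ (v.map_smul_of_tower _ _).symm
    have h0 : translate 0 w = w := by ext; simp [SchwartzMap.compSubConstCLM_apply]
    rw [zero_add, hl, h0, ← map_sub, ← map_sub]
    grw [hv, mul_assoc, Finset.sum_mul]
    rw [norm_pow, norm_norm]
    gcongr with a
    exact hw a h hh
  · refine Asymptotics.isLittleO_iff.2 fun c hc ↦ ?_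
    filter_upwards [Metric.closedBall_mem_nhds (0 : E) hc] with h hh
    rw [mem_closedBall_zero_iff] at hh
    rw [norm_pow, norm_norm, sq]
    gcongr

/-- Restriction of a Schwartz function to a slice with the second variable fixed. -/
def sliceLeft (y : R) : 𝓢(V × R, ℂ) →L[ℂ] 𝓢(V, ℂ) :=
  SchwartzMap.compCLM ℂ (g := fun x : V ↦ (x, y))
    (by
      have := (ContinuousLinearMap.inl ℝ V R).hasTemperateGrowth.add
        (Function.HasTemperateGrowth.const (0, y))
      convert this using 1
      ext x <;> simp)
    ⟨1, 1, fun x ↦ by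
      have := norm_fst_le (x, y)
      simp only [pow_one, one_mul] at this ⊢
      linarith⟩

@[simp] lemma sliceLeft_apply (y : R) (w : 𝓢(V × R, ℂ)) (x : V) :
    sliceLeft y w x = w (x, y) := rfl

/-- Exchange of the two variables. -/
def swap : 𝓢(V × R, ℂ) →L[ℂ] 𝓢(R × V, ℂ) :=
  SchwartzMap.compCLMOfContinuousLinearEquiv ℂ (ContinuousLinearEquiv.prodComm ℝ R V)

@[simp] lemma swap_apply (w : 𝓢(V × R, ℂ)) (x : V) (y : R) : swap w (y, x) = w (x, y) := rfl

/-- Restriction of a Schwartz function to a slice with the first variable fixed. -/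
def sliceRight (x : V) : 𝓢(V × R, ℂ) →L[ℂ] 𝓢(R, ℂ) := (sliceLeft x).comp swap

@[simp] lemma sliceRight_apply (x : V) (w : 𝓢(V × R, ℂ)) (y : R) :
    sliceRight x w y = w (x, y) := rfl

lemma pow_mul_seminorm_sliceLeft_le (j k l : ℕ) (w : 𝓢(V × R, ℂ)) (y : R) :
    ‖y‖ ^ j * SchwartzMap.seminorm ℂ k l (sliceLeft y w) ≤
      SchwartzMap.seminorm ℂ (k + j) l w := by
  by_cases hy : ‖y‖ ^ j = 0
  · rw [hy, zero_mul]; positivity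
  have hy' : 0 < ‖y‖ ^ j := by positivity
  rw [← le_div_iff₀' hy']
  refine SchwartzMap.seminorm_le_bound _ _ _ _ (by positivity) fun x ↦ ?_
  rw [le_div_iff₀' hy']
  have h1 : ‖iteratedFDeriv ℝ l (sliceLeft y w) x‖ ≤ ‖iteratedFDeriv ℝ l w (x, y)‖ := by
    have e : ⇑(sliceLeft y w) =
        (fun z ↦ w (z + (0, y))) ∘ ContinuousLinearMap.inl ℝ V R := by
      ext x; simp
    have hs : ContDiff ℝ l fun z ↦ w (z + (0, y)) :=
      (w.smooth l).comp (contDiff_id.add contDiff_const)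
    rw [e, ContinuousLinearMap.iteratedFDeriv_comp_right _ hs _ le_rfl,
      iteratedFDeriv_comp_add_right]
    refine (ContinuousMultilinearMap.norm_compContinuousLinearMap_le _ _).trans ?_
    simp only [ContinuousLinearMap.inl_apply, Prod.mk_add_mk, add_zero, zero_add,
      Finset.prod_const, Finset.card_univ, Fintype.card_fin]
    refine mul_le_of_le_one_right (norm_nonneg _) (pow_le_one₀ (norm_nonneg _) ?_)
    exact ContinuousLinearMap.opNorm_le_bound _ zero_le_one fun x ↦ by simp
  have h2 : ‖x‖ ≤ ‖(x, y)‖ := norm_fst_le (x, y)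
  have h3 : ‖y‖ ≤ ‖(x, y)‖ := norm_snd_le (x, y)
  calc ‖y‖ ^ j * (‖x‖ ^ k * ‖iteratedFDeriv ℝ l (sliceLeft y w) x‖)
      ≤ ‖(x, y)‖ ^ j * (‖(x, y)‖ ^ k * ‖iteratedFDeriv ℝ l w (x, y)‖) := by gcongr
    _ = ‖(x, y)‖ ^ (k + j) * ‖iteratedFDeriv ℝ l w (x, y)‖ := by ring
    _ ≤ _ := SchwartzMap.le_seminorm ℂ _ _ _ _

lemma hasFDerivAt_clm_sliceLeft [FiniteDimensional ℝ V] [FiniteDimensional ℝ R]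
    (u : 𝓢(V, ℂ) →L[ℂ] B) (w : 𝓢(V × R, ℂ)) (y : R) :
    HasFDerivAt (fun y ↦ u (sliceLeft y w))
      (∑ i, ((coordCLM (V × R) i).comp (ContinuousLinearMap.inr ℝ V R)).smulRight
        (u (sliceLeft y (∂_{Module.finBasis ℝ (V × R) i} w)))) y := by
  have h1 := hasFDerivAt_translate (u.comp (sliceLeft y)) w
  have h2 : HasFDerivAt (fun y' : R ↦ ((0 : V), y' - y)) (ContinuousLinearMap.inr ℝ V R) y :=
    (hasFDerivAt_const (0 : V) y).prodMk ((hasFDerivAt_id y).sub_const y)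
  have h3 := HasFDerivAt.comp (g := fun h ↦ (u.comp (sliceLeft y)) (translate h w)) y
    (by rw [sub_self, Prod.mk_zero_zero]; exact h1) h2
  refine (h3.congr_fderiv ?_).congr_of_eventuallyEq (Eventually.of_forall fun y' ↦ ?_)
  · ext; simp
  · simp only [Function.comp_apply, ContinuousLinearMap.comp_apply]
    congr 1
    ext x
    simp [SchwartzMap.compSubConstCLM_apply]

lemma continuous_clm_sliceLeft [FiniteDimensional ℝ V] [FiniteDimensional ℝ R]
    (u : 𝓢(V, ℂ) →L[ℂ] B) (w : 𝓢(V × R, ℂ)) : Continuous fun y ↦ u (sliceLeft y w) :=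
  continuous_iff_continuousAt.2 fun y ↦ (hasFDerivAt_clm_sliceLeft u w y).continuousAt

end Slices

section Augmentation

variable {V W R : Type*} [NormedAddCommGroup V] [NormedSpace ℝ V] [FiniteDimensional ℝ V]
  [NormedAddCommGroup W] [NormedSpace ℝ W]
  [NormedAddCommGroup R] [NormedSpace ℝ R] [FiniteDimensional ℝ R]

lemma continuous_augmentFun (F : 𝓢(V, ℂ) →L[ℂ] 𝓢(W, ℂ)) (w : 𝓢(V × R, ℂ)) :
    Continuous fun z : W × R ↦ F (sliceLeft z.2 w) z.1 := by
  have h := continuous_clm_sliceLeft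
    ((SchwartzMap.toBoundedContinuousFunctionCLM ℂ W ℂ).comp F) w
  exact (h.comp continuous_snd).eval continuous_fst

variable [FiniteDimensional ℝ W]

/-- The coordinate functionals along which the function `F ⊗ id` of a Schwartz function is
differentiated. -/
def augmentCoord (V W R : Type*) [NormedAddCommGroup V] [NormedSpace ℝ V] [FiniteDimensional ℝ V]
    [NormedAddCommGroup W] [NormedSpace ℝ W] [FiniteDimensional ℝ W]
    [NormedAddCommGroup R] [NormedSpace ℝ R] [FiniteDimensional ℝ R] :
    Fin (Module.finrank ℝ W) ⊕ Fin (Module.finrank ℝ (V × R)) → (W × R →L[ℝ] ℝ)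
  | .inl i => (coordCLM W i).comp (ContinuousLinearMap.fst ℝ W R)
  | .inr j => ((coordCLM (V × R) j).comp (ContinuousLinearMap.inr ℝ V R)).comp
      (ContinuousLinearMap.snd ℝ W R)

/-- The pairs of operators and functions occurring in the derivative of `F ⊗ id` of a Schwartz
function. -/
def augmentDeriv : Fin (Module.finrank ℝ W) ⊕ Fin (Module.finrank ℝ (V × R)) →
    (𝓢(V, ℂ) →L[ℂ] 𝓢(W, ℂ)) × 𝓢(V × R, ℂ) → (𝓢(V, ℂ) →L[ℂ] 𝓢(W, ℂ)) × 𝓢(V × R, ℂ)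
  | .inl i => fun a ↦
      ((LineDeriv.lineDerivOpCLM ℂ 𝓢(W, ℂ) (Module.finBasis ℝ W i)).comp a.1, a.2)
  | .inr j => fun a ↦ (a.1, ∂_{Module.finBasis ℝ (V × R) j} a.2)

lemma hasFDerivAt_augmentFun (a : (𝓢(V, ℂ) →L[ℂ] 𝓢(W, ℂ)) × 𝓢(V × R, ℂ)) (z : W × R) :
    HasFDerivAt (fun z : W × R ↦ a.1 (sliceLeft z.2 a.2) z.1)
      (∑ i, (augmentCoord V W R i).smulRight
        ((augmentDeriv i a).1 (sliceLeft z.2 (augmentDeriv i a).2) z.1)) z := by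
  obtain ⟨F, w⟩ := a
  let f₁ : W → R → W →L[ℝ] ℂ := fun x y ↦ ∑ i, (coordCLM W i).smulRight
    ((∂_{Module.finBasis ℝ W i} (F (sliceLeft y w))) x)
  let f₂ : W → R → R →L[ℝ] ℂ := fun x y ↦ ∑ j,
    ((coordCLM (V × R) j).comp (ContinuousLinearMap.inr ℝ V R)).smulRight
      (F (sliceLeft y (∂_{Module.finBasis ℝ (V × R) j} w)) x)
  have key := hasStrictFDerivAt_uncurry_coprod (𝕜 := ℝ) (u := z)
    (f := fun x y ↦ F (sliceLeft y w) x) (f₁ := f₁) (f₂ := f₂) ?_ ?_ ?_ ?_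
  · refine key.hasFDerivAt.congr_fderiv ?_
    simp only [Fintype.sum_sum_type]
    ext v <;> simp [f₁, f₂, augmentCoord, augmentDeriv, Function.HasUncurry.uncurry,
      ← Prod.zero_eq_mk]
  · refine Eventually.of_forall fun v ↦ ?_
    have := (F (sliceLeft v.2 w)).hasFDerivAt (x := v.1)
    rw [← sum_coordCLM_smulRight (fderiv ℝ _ _)] at this
    simp only [← SchwartzMap.lineDerivOp_apply_eq_fderiv] at this
    exact this
  · refine Eventually.of_forall fun v ↦ ?_
    exact hasFDerivAt_clm_sliceLeft ((BoundedContinuousFunction.evalCLM ℂ v.1).comp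
      ((SchwartzMap.toBoundedContinuousFunctionCLM ℂ W ℂ).comp F)) w v.2
  · have : Continuous fun v : W × R ↦ f₁ v.1 v.2 := continuous_finsetSum _ fun i _ ↦ (ContinuousLinearMap.smulRightL ℝ W ℂ (coordCLM W i)).continuous.comp
      (continuous_augmentFun
        ((LineDeriv.lineDerivOpCLM ℂ 𝓢(W, ℂ) (Module.finBasis ℝ W i)).comp F) w)
    exact this.continuousAt
  · have : Continuous fun v : W × R ↦ f₂ v.1 v.2 := continuous_finsetSum _ fun j _ ↦ (ContinuousLinearMap.smulRightL ℝ R ℂ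
      ((coordCLM (V × R) j).comp (ContinuousLinearMap.inr ℝ V R))).continuous.comp
      (continuous_augmentFun F _)
    exact this.continuousAt

lemma contDiff_augmentFun (F : 𝓢(V, ℂ) →L[ℂ] 𝓢(W, ℂ)) (w : 𝓢(V × R, ℂ)) :
    ContDiff ℝ ∞ fun z : W × R ↦ F (sliceLeft z.2 w) z.1 :=
  contDiff_of_closed_family
    (G := fun a : (𝓢(V, ℂ) →L[ℂ] 𝓢(W, ℂ)) × 𝓢(V × R, ℂ) ↦ fun z : W × R ↦
      a.1 (sliceLeft z.2 a.2) z.1) hasFDerivAt_augmentFun (F, w)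

lemma exists_seminorm_augmentFun_le (k l : ℕ) (F : 𝓢(V, ℂ) →L[ℂ] 𝓢(W, ℂ)) :
    ∃ q : Seminorm ℂ 𝓢(V × R, ℂ), Continuous q ∧ ∀ w (z : W × R), ‖z‖ ^ k *
      ‖iteratedFDeriv ℝ l (fun z : W × R ↦ F (sliceLeft z.2 w) z.1) z‖ ≤ q w := by
  induction l generalizing F with
  | zero =>
    have hp : ∀ k, ∃ (s : Finset (ℕ × ℕ)) (C : ℝ), 0 ≤ C ∧ ∀ f,
        SchwartzMap.seminorm ℂ k 0 (F f) ≤ C * ∑ a ∈ s, SchwartzMap.seminorm ℂ a.1 a.2 f :=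
      fun k ↦ exists_le_sum_seminorm
        (q := (SchwartzMap.seminorm ℂ k 0 : Seminorm ℂ 𝓢(W, ℂ)).comp F.toLinearMap)
        (by exact ((schwartz_withSeminorms ℂ W ℂ).continuous_seminorm (k, 0)).comp F.continuous)
    obtain ⟨s, C, hC, hs⟩ := hp k
    obtain ⟨s', C', hC', hs'⟩ := hp 0
    have hcont := (schwartz_withSeminorms ℂ (V × R) ℂ).continuous_seminorm
    refine ⟨C.toNNReal • ∑ a ∈ s, SchwartzMap.seminorm ℂ a.1 a.2 +
      C'.toNNReal • ∑ a ∈ s', SchwartzMap.seminorm ℂ (a.1 + k) a.2, ?_, fun w z ↦ ?_⟩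
    · have : Continuous fun w ↦ C.toNNReal • ∑ a ∈ s, SchwartzMap.seminorm ℂ a.1 a.2 w +
          C'.toNNReal • ∑ a ∈ s', SchwartzMap.seminorm ℂ (a.1 + k) a.2 w :=
        ((continuous_finsetSum _ fun a _ ↦ hcont a).const_smul _).add
          ((continuous_finsetSum _ fun a _ ↦ hcont (a.1 + k, a.2)).const_smul _)
      convert this using 2 with w
      simp [sum_apply]
    · obtain ⟨x, y⟩ := z
      set f := sliceLeft y w with hf
      have h0 : ‖(x, y)‖ ^ k ≤ ‖x‖ ^ k + ‖y‖ ^ k := by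
        rcases le_total ‖x‖ ‖y‖ with h | h
        · rw [Prod.norm_mk, max_eq_right h]; simp
        · rw [Prod.norm_mk, max_eq_left h]; simp
      have h1 : ‖x‖ ^ k * ‖F f x‖ ≤ C * ∑ a ∈ s, SchwartzMap.seminorm ℂ a.1 a.2 w := by
        have := SchwartzMap.le_seminorm ℂ k 0 (F f) x
        rw [norm_iteratedFDeriv_zero] at this
        grw [this, hs]
        gcongr with a
        simpa using pow_mul_seminorm_sliceLeft_le 0 a.1 a.2 w y
      have h2 : ‖y‖ ^ k * ‖F f x‖ ≤
          C' * ∑ a ∈ s', SchwartzMap.seminorm ℂ (a.1 + k) a.2 w := by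
        have := SchwartzMap.le_seminorm ℂ 0 0 (F f) x
        rw [norm_iteratedFDeriv_zero, pow_zero, one_mul] at this
        grw [this, hs', mul_left_comm, Finset.mul_sum]
        gcongr with a
        exact pow_mul_seminorm_sliceLeft_le k a.1 a.2 w y
      rw [norm_iteratedFDeriv_zero]
      grw [h0, add_mul, h1, h2]
      simp [sum_apply, NNReal.smul_def, hC, hC']
  | succ l ih =>
    choose q hq hqw using ih
    refine ⟨∑ i, ‖augmentCoord V W R i‖₊ • Sum.rec (motive := fun _ ↦ Seminorm ℂ 𝓢(V × R, ℂ))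
      (fun i ↦ q ((LineDeriv.lineDerivOpCLM ℂ 𝓢(W, ℂ) (Module.finBasis ℝ W i)).comp F))
      (fun j ↦ (q F).comp
        (LineDeriv.lineDerivOpCLM ℂ 𝓢(V × R, ℂ) (Module.finBasis ℝ (V × R) j)).toLinearMap) i,
      ?_, fun w z ↦ ?_⟩
    · have : Continuous fun w ↦ ∑ i, ‖augmentCoord V W R i‖₊ • (q (augmentDeriv i (F, w)).1
          (augmentDeriv i (F, w)).2) := by
        refine continuous_finsetSum _ fun i _ ↦ Continuous.const_smul ?_ _
        rcases i with i | j
        · exact hq ((LineDeriv.lineDerivOpCLM ℂ 𝓢(W, ℂ) (Module.finBasis ℝ W i)).comp F)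
        · exact (hq F).comp (LineDeriv.lineDerivOpCLM ℂ 𝓢(V × R, ℂ)
            (Module.finBasis ℝ (V × R) j)).continuous
      convert this using 2 with w
      simp [sum_apply, augmentDeriv]
    · grw [norm_iteratedFDeriv_succ_le_sum (hasFDerivAt_augmentFun (F, w))
        (fun i ↦ contDiff_augmentFun _ _), Finset.mul_sum]
      rw [sum_apply]
      refine Finset.sum_le_sum fun i _ ↦ ?_
      rw [mul_left_comm, smul_apply, NNReal.smul_def, coe_nnnorm, smul_eq_mul]
      gcongr
      rcases i with i | j
      · exact hqw _ _ _
      · exact hqw _ _ _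

/-- The augmentation `F ⊗ id` of a continuous linear operator between Schwartz spaces. -/
def augment (F : 𝓢(V, ℂ) →L[ℂ] 𝓢(W, ℂ)) : 𝓢(V × R, ℂ) →L[ℂ] 𝓢(W × R, ℂ) :=
  SchwartzMap.mkCLM (fun w z ↦ F (sliceLeft z.2 w) z.1)
    (fun _ _ _ ↦ by simp) (fun _ _ _ ↦ by simp) (contDiff_augmentFun F) fun n ↦ by
      obtain ⟨q, hq, hqw⟩ := exists_seminorm_augmentFun_le (R := R) n.1 n.2 F
      obtain ⟨s, C, -, h⟩ := Seminorm.bound_of_continuous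
        (schwartz_withSeminorms ℂ (V × R) ℂ) q hq
      exact ⟨s, C, C.2, fun w z ↦ (hqw w z).trans (h w)⟩

@[simp] lemma augment_apply (F : 𝓢(V, ℂ) →L[ℂ] 𝓢(W, ℂ)) (w : 𝓢(V × R, ℂ)) (x : W) (y : R) :
    augment F w (x, y) = F (sliceLeft y w) x := rfl

end Augmentation

section PartialIntegral

variable {Z E : Type*} [NormedAddCommGroup Z] [NormedSpace ℝ Z]
  [NormedAddCommGroup E] [NormedSpace ℝ E]

lemma lineDerivOp_sliceRight (z : Z) (v : E) (Φ : 𝓢(Z × E, ℂ)) :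
    ∂_{v} (sliceRight z Φ) = sliceRight z (∂_{((0 : Z), v)} Φ) := by
  ext y
  simp only [SchwartzMap.lineDerivOp_apply_eq_fderiv, sliceRight_apply]
  have h : HasFDerivAt (fun y ↦ Φ (z, y))
      ((fderiv ℝ Φ (z, y)).comp (ContinuousLinearMap.inr ℝ Z E)) y :=
    (Φ.hasFDerivAt (x := (z, y))).comp y (hasFDerivAt_prodMk_right z y)
  exact congrArg (fun L : E →L[ℝ] ℂ ↦ L v) h.fderiv

lemma exists_apply_zero_eq_one (Z : Type*) [NormedAddCommGroup Z] [NormedSpace ℝ Z]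
    [FiniteDimensional ℝ Z] : ∃ ρ : 𝓢(Z, ℂ), ρ 0 = 1 := by
  let f : ContDiffBump (0 : Z) := default
  have h1 : HasCompactSupport fun z : Z ↦ (f z : ℂ) :=
    f.hasCompactSupport.comp_left Complex.ofReal_zero
  refine ⟨h1.toSchwartzMap (Complex.ofRealCLM.contDiff.comp f.contDiff), ?_⟩
  change ((f 0 : ℝ) : ℂ) = 1
  rw [f.one_of_mem_closedBall (by simpa using f.rIn_pos.le), Complex.ofReal_one]

variable [FiniteDimensional ℝ Z] [FiniteDimensional ℝ E] [MeasurableSpace Z] [BorelSpace Z]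
  (μ : Measure Z) [μ.HasTemperateGrowth]

/-- Integration of a Schwartz function in the first variable. -/
def partialIntegral : 𝓢(Z × E, ℂ) →L[ℂ] 𝓢(E, ℂ) :=
  (sliceRight 0).comp (augment
    ((SchwartzMap.integralCLM ℂ μ).smulRight (exists_apply_zero_eq_one Z).choose))

lemma partialIntegral_apply (Φ : 𝓢(Z × E, ℂ)) (y : E) :
    partialIntegral μ Φ y = ∫ z, Φ (z, y) ∂μ := by
  simp [partialIntegral, (exists_apply_zero_eq_one Z).choose_spec,
    SchwartzMap.integralCLM_apply]

lemma lineDerivOp_partialIntegral (v : E) (Φ : 𝓢(Z × E, ℂ)) :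
    ∂_{v} (partialIntegral μ Φ) = partialIntegral μ (∂_{((0 : Z), v)} Φ) := by
  ext y
  have h := hasFDerivAt_clm_sliceLeft (SchwartzMap.integralCLM ℂ μ : 𝓢(Z, ℂ) →L[ℂ] ℂ) Φ y
  have e : (fun y ↦ (SchwartzMap.integralCLM ℂ μ : 𝓢(Z, ℂ) →L[ℂ] ℂ) (sliceLeft y Φ)) =
      partialIntegral μ Φ :=
    funext fun y ↦ (partialIntegral_apply μ Φ y).symm
  rw [e] at h
  rw [SchwartzMap.lineDerivOp_apply_eq_fderiv, h.fderiv]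
  have e' : partialIntegral μ (∂_{((0 : Z), v)} Φ) y =
      SchwartzMap.integralCLM ℂ μ (sliceLeft y (∂_{((0 : Z), v)} Φ)) :=
    partialIntegral_apply μ _ y
  rw [e', ← sum_coordCLM_smul ((0 : Z), v), LineDeriv.lineDerivOp_left_sum, map_sum, map_sum,
    sum_apply]
  refine Finset.sum_congr rfl fun i _ ↦ ?_
  rw [LineDeriv.lineDerivOp_left_smul]
  let L : 𝓢(Z × E, ℂ) →L[ℂ] ℂ := (SchwartzMap.integralCLM ℂ μ).comp (sliceLeft y)
  rw [ContinuousLinearMap.smulRight_apply]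
  exact (L.map_smul_of_tower (coordCLM (Z × E) i (0, v)) _).symm

lemma integrable_clm_sliceRight {B : Type*} [NormedAddCommGroup B] [NormedSpace ℂ B]
    (v : 𝓢(E, ℂ) →L[ℂ] B) (Φ : 𝓢(Z × E, ℂ)) :
    Integrable (fun z ↦ v (sliceRight z Φ)) μ := by
  obtain ⟨s, C, hC, hv⟩ := exists_norm_le_sum_seminorm v
  have hb : ∀ (j : ℕ) (z : Z), ‖z‖ ^ j * ‖v (sliceRight z Φ)‖ ≤
      C * ∑ a ∈ s, SchwartzMap.seminorm ℂ (a.1 + j) a.2 (swap Φ) := fun j z ↦ by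
    grw [hv, mul_left_comm, Finset.mul_sum]
    gcongr with a
    exact pow_mul_seminorm_sliceLeft_le j a.1 a.2 (swap Φ) z
  have hc : Continuous fun z ↦ v (sliceRight z Φ) := continuous_clm_sliceLeft v (swap Φ)
  have := integrable_of_le_of_pow_mul_le (μ := μ) (k := 0) (f := fun z ↦ v (sliceRight z Φ))
    (fun z ↦ by simpa using hb 0 z) (fun z ↦ hb _ z) hc.aestronglyMeasurable
  simp only [pow_zero, one_mul] at this
  exact (integrable_norm_iff hc.aestronglyMeasurable).1 this

end PartialIntegral

section Interchange

lemma apply_eq_zero_of_eq_integral {A X α : Type*} [AddCommGroup A] [Module ℂ A]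
    [NormedAddCommGroup X] [NormedSpace ℂ X] [CompleteSpace X] [MeasurableSpace α]
    {μ : Measure α} {u : A →ₗ[ℂ] ℂ} {J : A →ₗ[ℂ] X} {C : ℝ} (hu : ∀ f, ‖u f‖ ≤ C * ‖J f‖)
    {g : α → A} (hg : Integrable (fun z ↦ J (g z)) μ) (hug : ∀ z, u (g z) = 0) {a : A}
    (ha : J a = ∫ z, J (g z) ∂μ) : u a = 0 := by
  let S : Submodule ℂ X := ((LinearMap.ker u).map J).topologicalClosure
  have : IsClosed (S : Set X) := Submodule.isClosed_topologicalClosure _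
  have hS : J a ∈ S := by
    have h := S.mkQL.integral_comp_comm hg
    have h0 : ∀ z, S.mkQL (J (g z)) = 0 := fun z ↦
      (Submodule.Quotient.mk_eq_zero S).2
        (Submodule.le_topologicalClosure _ (Submodule.mem_map_of_mem (hug z)))
    simp only [h0, integral_zero, ← ha] at h
    exact (Submodule.Quotient.mk_eq_zero S).1 h.symm
  have hC : ∀ ε > 0, ‖u a‖ ≤ |C| * ε := fun ε hε ↦ by
    obtain ⟨_, ⟨b, hb, rfl⟩, hab⟩ := Metric.mem_closure_iff.1 hS ε hε
    have hb : u b = 0 := hb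
    rw [dist_eq_norm, ← map_sub] at hab
    calc ‖u a‖ = ‖u (a - b)‖ := by rw [map_sub, hb, sub_zero]
      _ ≤ C * ‖J (a - b)‖ := hu _
      _ ≤ |C| * ε := by
        gcongr
        exact le_abs_self C
  have hlim : Tendsto (fun ε : ℝ ↦ |C| * ε) (𝓝[>] 0) (𝓝 (|C| * 0)) :=
    (tendsto_id.const_mul _).mono_left nhdsWithin_le_nhds
  rw [mul_zero] at hlim
  exact norm_le_zero_iff.1 (ge_of_tendsto hlim (eventually_mem_nhdsWithin.mono hC))

variable {Z E : Type*} [NormedAddCommGroup Z] [NormedSpace ℝ Z] [FiniteDimensional ℝ Z]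
  [NormedAddCommGroup E] [NormedSpace ℝ E]

/-- Multiplication by `‖x‖ ^ k`, from Schwartz functions to bounded continuous functions. -/
def normPowMul (k : ℕ) : 𝓢(E, ℂ) →L[ℂ] E →ᵇ ℂ :=
  SchwartzMap.mkCLMtoNormedSpace
    (fun f ↦ BoundedContinuousFunction.ofNormedAddCommGroup (fun x ↦ ‖x‖ ^ k • f x)
      (by fun_prop) (SchwartzMap.seminorm ℂ k 0 f) fun x ↦ by
        simpa [norm_smul] using SchwartzMap.le_seminorm ℂ k 0 f x)
    (fun f g ↦ by ext; simp) (fun c f ↦ by ext; simp [mul_left_comm])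
    ⟨{(k, 0)}, 1, zero_le_one, fun f ↦ by
      rw [one_mul, Finset.sup_singleton]
      exact BoundedContinuousFunction.norm_ofNormedAddCommGroup_le _ (apply_nonneg _ _) _⟩

lemma normPowMul_apply (k : ℕ) (f : 𝓢(E, ℂ)) (x : E) :
    normPowMul k f x = (‖x‖ ^ k : ℂ) * f x := by
  change ‖x‖ ^ k • f x = _
  simp

lemma seminorm_zero_le_norm_normPowMul (k : ℕ) (f : 𝓢(E, ℂ)) :
    SchwartzMap.seminorm ℂ k 0 f ≤ ‖normPowMul k f‖ := by
  refine SchwartzMap.seminorm_le_bound _ _ _ _ (norm_nonneg _) fun x ↦ ?_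
  refine le_trans (le_of_eq ?_) ((normPowMul k f).norm_coe_le_norm x)
  rw [normPowMul_apply]
  simp

variable [FiniteDimensional ℝ E] [MeasurableSpace Z] [BorelSpace Z]
  (μ : Measure Z) [μ.HasTemperateGrowth]

lemma exists_seminorm_le_sum_normPowMul (k l : ℕ) :
    ∃ (ι : Type) (_ : Fintype ι) (D : ι → 𝓢(E, ℂ) →L[ℂ] 𝓢(E, ℂ))
      (D' : ι → 𝓢(Z × E, ℂ) →L[ℂ] 𝓢(Z × E, ℂ)) (C : ℝ), 0 ≤ C ∧
      (∀ i z Φ, D i (sliceRight z Φ) = sliceRight z (D' i Φ)) ∧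
      (∀ i Φ, D i (partialIntegral μ Φ) = partialIntegral μ (D' i Φ)) ∧
      ∀ f, SchwartzMap.seminorm ℂ k l f ≤ C * ∑ i, ‖normPowMul k (D i f)‖ := by
  induction l with
  | zero =>
    exact ⟨Unit, inferInstance, fun _ ↦ .id ℂ _, fun _ ↦ .id ℂ _, 1, zero_le_one,
      fun _ _ _ ↦ rfl, fun _ _ ↦ rfl, fun f ↦ by
        simpa using seminorm_zero_le_norm_normPowMul k f⟩
  | succ l ih =>
    obtain ⟨ι, _, D, D', C, hC, h1, h2, h3⟩ := ih
    obtain ⟨C₀, hC₀, hs⟩ := exists_seminorm_succ_le (E := E)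
    refine ⟨Fin (Module.finrank ℝ E) × ι, inferInstance,
      fun i ↦ (D i.2).comp (LineDeriv.lineDerivOpCLM ℂ 𝓢(E, ℂ) (Module.finBasis ℝ E i.1)),
      fun i ↦ (D' i.2).comp (LineDeriv.lineDerivOpCLM ℂ 𝓢(Z × E, ℂ)
        ((0 : Z), Module.finBasis ℝ E i.1)), C₀ * C, by positivity, fun i z Φ ↦ ?_,
      fun i Φ ↦ ?_, fun f ↦ ?_⟩
    · simp [lineDerivOp_sliceRight, h1]
    · simp [lineDerivOp_partialIntegral, h2]
    · rw [mul_assoc, Fintype.sum_prod_type, Finset.mul_sum]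
      exact (hs k l f).trans
        (mul_le_mul_of_nonneg_left (Finset.sum_le_sum fun i _ ↦ h3 _) hC₀)

lemma clm_partialIntegral_eq_zero (u : 𝓢(E, ℂ) →L[ℂ] ℂ) (Φ : 𝓢(Z × E, ℂ))
    (hu : ∀ z, u (sliceRight z Φ) = 0) : u (partialIntegral μ Φ) = 0 := by
  obtain ⟨s, C, hC, hus⟩ := exists_norm_le_sum_seminorm u
  choose ι _ D D' K hK h1 h2 h3 using fun a : ℕ × ℕ ↦
    exists_seminorm_le_sum_normPowMul (E := E) μ a.1 a.2
  let J : 𝓢(E, ℂ) →L[ℂ] ((Σ a : s, ι a) → E →ᵇ ℂ) :=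
    ContinuousLinearMap.pi fun i ↦ (normPowMul i.1.1.1).comp (D i.1 i.2)
  refine apply_eq_zero_of_eq_integral (μ := μ) (u := u.toLinearMap) (J := J.toLinearMap)
    (C := C * ∑ a : s, K a * Fintype.card (ι a)) (g := fun z ↦ sliceRight z Φ) (fun f ↦ ?_)
    (integrable_clm_sliceRight μ J Φ) hu ?_
  · refine (hus f).trans ?_
    rw [mul_assoc, Finset.sum_mul, ← Finset.sum_coe_sort]
    gcongr with a
    refine (h3 a f).trans ?_
    rw [mul_assoc]
    gcongr
    · exact hK a
    rw [← nsmul_eq_mul]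
    exact Finset.sum_le_card_nsmul _ _ _ fun i _ ↦ norm_le_pi_norm (J f) ⟨a, i⟩
  · ext i y
    have hJ := integrable_clm_sliceRight μ J Φ
    have := ((BoundedContinuousFunction.evalCLM ℂ y).comp
      (ContinuousLinearMap.proj (R := ℂ) (φ := fun _ : (Σ a : s, ι a) ↦ E →ᵇ ℂ)
        i)).integral_comp_comm hJ
    refine Eq.trans ?_ this
    change normPowMul i.1.1.1 (D i.1 i.2 (partialIntegral μ Φ)) y =
      ∫ z, normPowMul i.1.1.1 (D i.1 i.2 (sliceRight z Φ)) y ∂μ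
    simp only [normPowMul_apply, h1, h2, sliceRight_apply, partialIntegral_apply]
    rw [integral_const_mul]

end Interchange

section Density

variable {V R : Type*} [NormedAddCommGroup V] [NormedSpace ℝ V] [FiniteDimensional ℝ V]
  [NormedAddCommGroup R] [NormedSpace ℝ R] [FiniteDimensional ℝ R]

/-- Evaluation of Schwartz functions at a point. -/
def evalAt {E : Type*} [NormedAddCommGroup E] [NormedSpace ℝ E] (x : E) : 𝓢(E, ℂ) →L[ℂ] ℂ :=
  (BoundedContinuousFunction.evalCLM ℂ x).comp (SchwartzMap.toBoundedContinuousFunctionCLM ℂ E ℂ)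

@[simp] lemma evalAt_apply {E : Type*} [NormedAddCommGroup E] [NormedSpace ℝ E] (x : E)
    (f : 𝓢(E, ℂ)) : evalAt x f = f x := rfl

/-- The tensor product `f ⊠ g` of two Schwartz functions. -/
def tensor (f : 𝓢(V, ℂ)) : 𝓢(R, ℂ) →L[ℂ] 𝓢(V × R, ℂ) :=
  (augment ((evalAt (0 : Fin 0 → ℝ)).smulRight f)).comp
    (SchwartzMap.compCLMOfContinuousLinearEquiv ℂ
      (ContinuousLinearEquiv.uniqueProd ℝ R (Fin 0 → ℝ)))

lemma tensor_apply (f : 𝓢(V, ℂ)) (g : 𝓢(R, ℂ)) (x : V) (y : R) :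
    tensor f g (x, y) = f x * g y := by
  simp [tensor, mul_comm]

/-- The linear change of variables `(z, (x, y)) ↦ (z, (x, y - z))`. -/
def shear (V R : Type*) [NormedAddCommGroup V] [NormedSpace ℝ V]
    [NormedAddCommGroup R] [NormedSpace ℝ R] : (R × V × R) ≃L[ℝ] R × V × R :=
  let p₁ := ContinuousLinearMap.fst ℝ R (V × R)
  let p₂ := (ContinuousLinearMap.fst ℝ V R).comp (ContinuousLinearMap.snd ℝ R (V × R))
  let p₃ := (ContinuousLinearMap.snd ℝ V R).comp (ContinuousLinearMap.snd ℝ R (V × R))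
  ContinuousLinearEquiv.equivOfInverse (p₁.prod (p₂.prod (p₃ - p₁))) (p₁.prod (p₂.prod (p₃ + p₁)))
    (fun _ ↦ by simp [p₁, p₂, p₃]) (fun _ ↦ by simp [p₁, p₂, p₃])

/-- The linear change of variables `(z, (x, y)) ↦ (y - z, (x, z))`. -/
def shearSwap (V R : Type*) [NormedAddCommGroup V] [NormedSpace ℝ V]
    [NormedAddCommGroup R] [NormedSpace ℝ R] : (R × V × R) ≃L[ℝ] R × V × R :=
  let p₁ := ContinuousLinearMap.fst ℝ R (V × R)
  let p₂ := (ContinuousLinearMap.fst ℝ V R).comp (ContinuousLinearMap.snd ℝ R (V × R))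
  let p₃ := (ContinuousLinearMap.snd ℝ V R).comp (ContinuousLinearMap.snd ℝ R (V × R))
  ContinuousLinearEquiv.equivOfInverse ((p₃ - p₁).prod (p₂.prod p₁)) (p₃.prod (p₂.prod (p₁ + p₃)))
    (fun _ ↦ by simp [p₁, p₂, p₃]) (fun _ ↦ by simp [p₁, p₂, p₃])

/-- The function `(z, (x, y)) ↦ φ z * w (x, y - z)`. -/
def mollifyKernel (φ : 𝓢(R, ℂ)) : 𝓢(V × R, ℂ) →L[ℂ] 𝓢(R × V × R, ℂ) :=
  (SchwartzMap.compCLMOfContinuousLinearEquiv ℂ (shear V R)).comp (tensor φ)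

lemma mollifyKernel_apply (φ : 𝓢(R, ℂ)) (w : 𝓢(V × R, ℂ)) (z : R) (x : V) (y : R) :
    mollifyKernel φ w (z, x, y) = φ z * w (x, y - z) :=
  tensor_apply φ w z (x, y - z)

lemma sliceRight_mollifyKernel (φ : 𝓢(R, ℂ)) (w : 𝓢(V × R, ℂ)) (z : R) :
    sliceRight z (mollifyKernel φ w) = φ z • translate (0, -z) w := by
  ext ⟨x, y⟩
  simp [mollifyKernel_apply, SchwartzMap.compSubConstCLM_apply]

lemma lineDerivOp_mollifyKernel (φ : 𝓢(R, ℂ)) (w : 𝓢(V × R, ℂ)) (v : V × R) :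
    ∂_{((0 : R), v)} (mollifyKernel φ w) = mollifyKernel φ (∂_{v} w) := by
  ext ⟨z, p⟩
  rw [← sliceRight_apply z _ p, ← sliceRight_apply z _ p, ← lineDerivOp_sliceRight, sliceRight_mollifyKernel, sliceRight_mollifyKernel,
    ← lineDerivOp_translate, LineDeriv.lineDerivOp_smul]

variable [MeasurableSpace R] [BorelSpace R] (μ : Measure R) [μ.IsAddHaarMeasure]

/-- Convolution in the second variable. -/
def mollify (φ : 𝓢(R, ℂ)) : 𝓢(V × R, ℂ) →L[ℂ] 𝓢(V × R, ℂ) :=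
  (partialIntegral μ).comp (mollifyKernel φ)

lemma mollify_apply (φ : 𝓢(R, ℂ)) (w : 𝓢(V × R, ℂ)) (p : V × R) :
    mollify μ φ w p = ∫ z, φ z * w (p + (0, -z)) ∂μ := by
  obtain ⟨x, y⟩ := p
  simp [mollify, partialIntegral_apply, mollifyKernel_apply, sub_eq_add_neg]

lemma lineDerivOp_mollify (φ : 𝓢(R, ℂ)) (w : 𝓢(V × R, ℂ)) (v : V × R) :
    ∂_{v} (mollify μ φ w) = mollify μ φ (∂_{v} w) := by
  simp [mollify, lineDerivOp_partialIntegral, lineDerivOp_mollifyKernel]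

lemma exists_seminorm_mollify_sub_le (k l : ℕ) (w : 𝓢(V × R, ℂ)) : ∃ C, 0 ≤ C ∧
    ∀ (ε : ℝ) (φ : 𝓢(R, ℂ)), ε ≤ 1 → (∀ z, ε < ‖z‖ → φ z = 0) → ∫ z, φ z ∂μ = 1 →
      ∫ z, ‖φ z‖ ∂μ ≤ 1 → 0 ≤ ε →
      SchwartzMap.seminorm ℂ k l (mollify μ φ w - w) ≤ C * ε := by
  induction l generalizing w with
  | zero =>
    obtain ⟨C, hC, hw⟩ := exists_pow_mul_norm_add_sub_le w k
    refine ⟨C, hC, fun ε φ hε hsupp hφ hφ' hε0 ↦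
      SchwartzMap.seminorm_le_bound _ _ _ _ (by positivity) fun p ↦ ?_⟩
    have hi : Integrable (fun z ↦ φ z * w (p + (0, -z))) μ := by
      have := integrable_clm_sliceRight μ (evalAt p) (mollifyKernel φ w)
      simpa [sliceRight_mollifyKernel, SchwartzMap.compSubConstCLM_apply, sub_eq_add_neg]
        using this
    have e : (‖p‖ ^ k : ℂ) * (mollify μ φ w - w) p =
        ∫ z, (‖p‖ ^ k : ℂ) * (φ z * (w (p + (0, -z)) - w p)) ∂μ := by
      rw [integral_const_mul]
      congr 1
      simp only [mul_sub]
      rw [integral_sub hi (φ.integrable.mul_const _), integral_mul_const, hφ, one_mul,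
        sub_apply, mollify_apply]
    have hb : ∀ z, ‖(‖p‖ ^ k : ℂ) * (φ z * (w (p + (0, -z)) - w p))‖ ≤ ‖φ z‖ * (C * ε) := by
      intro z
      by_cases hz : ε < ‖z‖
      · simp [hsupp z hz]
      · push Not at hz
        have hn : ‖((0 : V), -z)‖ = ‖z‖ := by simp [Prod.norm_mk]
        have := hw (0, -z) p (by rw [hn]; exact hz.trans hε)
        rw [hn] at this
        rw [norm_mul, norm_mul, mul_left_comm]
        simp only [norm_pow, Complex.norm_real, norm_norm]
        grw [this, hz]
    have := norm_integral_le_of_norm_le ((φ.integrable (μ := μ)).norm.mul_const (C * ε))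
      (Eventually.of_forall hb)
    rw [← e, integral_mul_const, norm_mul, norm_pow, Complex.norm_real, norm_norm] at this
    rw [norm_iteratedFDeriv_zero]
    refine this.trans ?_
    exact mul_le_of_le_one_left (by positivity) hφ'
  | succ l ih =>
    obtain ⟨C₀, hC₀, hs⟩ := exists_seminorm_succ_le (E := V × R)
    choose C hC hw using fun i ↦ ih (∂_{Module.finBasis ℝ (V × R) i} w)
    refine ⟨C₀ * ∑ i, C i, mul_nonneg hC₀ (Finset.sum_nonneg fun i _ ↦ hC i),
      fun ε φ hε hsupp hφ hφ' hε0 ↦ ?_⟩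
    grw [hs, mul_assoc, Finset.sum_mul]
    gcongr with i
    refine le_trans (le_of_eq ?_) (hw i ε φ hε hsupp hφ hφ' hε0)
    congr 1
    rw [← lineDerivOp_mollify]
    simp only [← LineDeriv.lineDerivOpCLM_apply (R := ℂ), map_sub]

lemma exists_approxIdentity {ε : ℝ} (hε : 0 < ε) : ∃ φ : 𝓢(R, ℂ),
    (∀ z, ε < ‖z‖ → φ z = 0) ∧ ∫ z, φ z ∂μ = 1 ∧ ∫ z, ‖φ z‖ ∂μ ≤ 1 := by
  let f : ContDiffBump (0 : R) := ⟨ε / 2, ε, half_pos hε, half_lt_self hε⟩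
  have h1 : HasCompactSupport fun z : R ↦ (f.normed μ z : ℂ) :=
    f.hasCompactSupport_normed.comp_left Complex.ofReal_zero
  refine ⟨h1.toSchwartzMap (Complex.ofRealCLM.contDiff.comp f.contDiff_normed),
    fun z hz ↦ ?_, ?_, ?_⟩
  · change ((f.normed μ z : ℝ) : ℂ) = 0
    have : z ∉ Function.support (f.normed μ) := by
      rw [f.support_normed_eq]
      simpa [f] using hz.le
    rw [Function.notMem_support.1 this, Complex.ofReal_zero]
  · change ∫ z, ((f.normed μ z : ℝ) : ℂ) ∂μ = 1
    rw [integral_complex_ofReal, f.integral_normed, Complex.ofReal_one]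
  · change ∫ z, ‖((f.normed μ z : ℝ) : ℂ)‖ ∂μ ≤ 1
    simp only [Complex.norm_real, Real.norm_of_nonneg (f.nonneg_normed _)]
    exact f.integral_normed.le

lemma clm_mollify_eq_zero {u : 𝓢(V × R, ℂ) →L[ℂ] ℂ}
    (hu : ∀ (f : 𝓢(V, ℂ)) (g : 𝓢(R, ℂ)) (w : 𝓢(V × R, ℂ)),
      (∀ x y, w (x, y) = f x * g y) → u w = 0) (φ : 𝓢(R, ℂ)) (w : 𝓢(V × R, ℂ)) :
    u (mollify μ φ w) = 0 := by
  let Φ : 𝓢(R × V × R, ℂ) :=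
    SchwartzMap.compCLMOfContinuousLinearEquiv ℂ (shearSwap V R) (tensor φ w)
  have hΦ : ∀ z x y, Φ (z, x, y) = φ (y - z) * w (x, z) := fun z x y ↦
    tensor_apply φ w (y - z) (x, z)
  have e : mollify μ φ w = partialIntegral μ Φ := by
    ext ⟨x, y⟩
    rw [mollify_apply, partialIntegral_apply, ← integral_sub_left_eq_self _ μ y]
    simp [hΦ]
  rw [e]
  refine clm_partialIntegral_eq_zero μ u Φ fun z ↦
    hu (sliceLeft z w) (SchwartzMap.compSubConstCLM ℂ z φ) _ fun x y ↦ ?_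
  simp [hΦ, SchwartzMap.compSubConstCLM_apply, mul_comm]

/-- The tensor products `f ⊠ g` span a dense subspace: a continuous functional vanishing on all of
them is zero. -/
lemma clm_eq_zero_of_tensor {u : 𝓢(V × R, ℂ) →L[ℂ] ℂ}
    (hu : ∀ (f : 𝓢(V, ℂ)) (g : 𝓢(R, ℂ)) (w : 𝓢(V × R, ℂ)),
      (∀ x y, w (x, y) = f x * g y) → u w = 0) (w : 𝓢(V × R, ℂ)) : u w = 0 := by
  let μ : Measure R := Measure.addHaar
  obtain ⟨s, C, hC, hus⟩ := exists_norm_le_sum_seminorm u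
  choose K hK hw using fun a : ℕ × ℕ ↦ exists_seminorm_mollify_sub_le μ a.1 a.2 w
  have hb : ∀ ε ∈ Set.Ioc (0 : ℝ) 1, ‖u w‖ ≤ (C * ∑ a ∈ s, K a) * ε := fun ε hε ↦ by
    obtain ⟨φ, h1, h2, h3⟩ := exists_approxIdentity μ hε.1
    have : u w = - u (mollify μ φ w - w) := by
      rw [map_sub, clm_mollify_eq_zero μ hu]; simp
    rw [this, norm_neg]
    grw [hus, mul_assoc, Finset.sum_mul]
    gcongr with a
    exact hw a ε φ hε.2 h1 h2 h3 hε.1.le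
  have hlim : Tendsto (fun ε : ℝ ↦ (C * ∑ a ∈ s, K a) * ε) (𝓝[>] 0)
      (𝓝 ((C * ∑ a ∈ s, K a) * 0)) :=
    (tendsto_id.const_mul _).mono_left nhdsWithin_le_nhds
  rw [mul_zero] at hlim
  refine norm_le_zero_iff.1 (ge_of_tendsto hlim ?_)
  filter_upwards [Ioc_mem_nhdsGT (zero_lt_one' ℝ)] using hb

end Density

section Assembly

variable {V₁ V₂ W₁ W₂ : Type*}
  [NormedAddCommGroup V₁] [NormedSpace ℝ V₁] [NormedAddCommGroup V₂] [NormedSpace ℝ V₂]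
  [NormedAddCommGroup W₁] [NormedSpace ℝ W₁] [NormedAddCommGroup W₂] [NormedSpace ℝ W₂]
  {F : 𝓢(V₁, ℂ) →L[ℂ] 𝓢(W₁, ℂ)} {F' : 𝓢(V₂, ℂ) →L[ℂ] 𝓢(W₂, ℂ)}

lemma tChar_comp_left_right {A : 𝓢(V₁ × V₂, ℂ) →L[ℂ] 𝓢(W₁ × V₂, ℂ)}
    {B : 𝓢(W₁ × V₂, ℂ) →L[ℂ] 𝓢(W₁ × W₂, ℂ)} (hA : TChar F (.id ℂ _) A)
    (hB : TChar (.id ℂ _) F' B) : TChar F F' (B.comp A) :=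
  fun f g w hw ↦ hB (F f) g (A w) (hA f g w hw)

lemma tChar_comp_right_left {A : 𝓢(V₁ × V₂, ℂ) →L[ℂ] 𝓢(V₁ × W₂, ℂ)}
    {B : 𝓢(V₁ × W₂, ℂ) →L[ℂ] 𝓢(W₁ × W₂, ℂ)} (hA : TChar (.id ℂ _) F' A)
    (hB : TChar F (.id ℂ _) B) : TChar F F' (B.comp A) :=
  fun f g w hw ↦ hB f (F' g) (A w) (hA f g w hw)

lemma tChar_augment [FiniteDimensional ℝ V₁] [FiniteDimensional ℝ V₂] [FiniteDimensional ℝ W₁]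
    (F : 𝓢(V₁, ℂ) →L[ℂ] 𝓢(W₁, ℂ)) :
    TChar F (.id ℂ 𝓢(V₂, ℂ)) (augment F) := by
  intro f g w hw x y
  have : sliceLeft y w = g y • f := by
    ext x
    simp [hw, mul_comm]
  simp [this, mul_comm]

lemma tChar_swap_augment_swap [FiniteDimensional ℝ V₁] [FiniteDimensional ℝ V₂]
    [FiniteDimensional ℝ W₂] (F' : 𝓢(V₂, ℂ) →L[ℂ] 𝓢(W₂, ℂ)) :
    TChar (.id ℂ 𝓢(V₁, ℂ)) F' (swap.comp ((augment F').comp swap)) := by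
  intro f g w hw x y
  rw [mul_comm]
  exact tChar_augment F' g f (swap w) (fun y x ↦ by simp [hw, mul_comm]) y x

lemma TChar.unique [FiniteDimensional ℝ V₁] [FiniteDimensional ℝ V₂]
    [MeasurableSpace V₂] [BorelSpace V₂] {T T' : 𝓢(V₁ × V₂, ℂ) →L[ℂ] 𝓢(W₁ × W₂, ℂ)}
    (hT : TChar F F' T) (hT' : TChar F F' T') : T = T' := by
  ext w ⟨x, y⟩
  have := clm_eq_zero_of_tensor (u := (evalAt (x, y)).comp (T - T'))
    (fun f g w hw ↦ by simp [hT f g w hw, hT' f g w hw]) w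
  simpa [sub_eq_zero] using this

end Assembly

end SchwartzTensor

/-- For continuous linear maps `F : 𝓢(ℝⁿ) → 𝓢(ℝᵐ)` and
`F' : 𝓢(ℝ^{n'}) → 𝓢(ℝ^{m'})` there is a unique continuous linear map
`T : 𝓢(ℝ^{n+n'}) → 𝓢(ℝ^{m+m'})` with `T (f ⊠ f') = F f ⊠ F' f'`; furthermore
`T = (F ⊗ id) ∘ (id ⊗ F') = (id ⊗ F') ∘ (F ⊗ id)`, i.e. `T` agrees with both compositions
of augmentations acting on disjoint groups of variables. -/
theorem statement5 (n n' m m' : ℕ)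
    (F : SchwartzMap (Euc n) ℂ →L[ℂ] SchwartzMap (Euc m) ℂ)
    (F' : SchwartzMap (Euc n') ℂ →L[ℂ] SchwartzMap (Euc m') ℂ) :
    ∃ T : SchwartzMap (Euc n × Euc n') ℂ →L[ℂ] SchwartzMap (Euc m × Euc m') ℂ,
      TChar F F' T ∧
      (∀ T' : SchwartzMap (Euc n × Euc n') ℂ →L[ℂ] SchwartzMap (Euc m × Euc m') ℂ,
          TChar F F' T' → T' = T) ∧
      (∀ (A : SchwartzMap (Euc n × Euc n') ℂ →L[ℂ] SchwartzMap (Euc m × Euc n') ℂ)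
          (B : SchwartzMap (Euc m × Euc n') ℂ →L[ℂ] SchwartzMap (Euc m × Euc m') ℂ),
          TChar F (ContinuousLinearMap.id ℂ (SchwartzMap (Euc n') ℂ)) A →
          TChar (ContinuousLinearMap.id ℂ (SchwartzMap (Euc m) ℂ)) F' B →
          T = B.comp A) ∧
      (∀ (A' : SchwartzMap (Euc n × Euc n') ℂ →L[ℂ] SchwartzMap (Euc n × Euc m') ℂ)
          (B' : SchwartzMap (Euc n × Euc m') ℂ →L[ℂ] SchwartzMap (Euc m × Euc m') ℂ),
          TChar (ContinuousLinearMap.id ℂ (SchwartzMap (Euc n) ℂ)) F' A' →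
          TChar F (ContinuousLinearMap.id ℂ (SchwartzMap (Euc m') ℂ)) B' →
          T = B'.comp A') := by
  have hT := SchwartzTensor.tChar_comp_left_right (SchwartzTensor.tChar_augment F)
    (SchwartzTensor.tChar_swap_augment_swap F')
  refine ⟨_, hT, fun T' hT' ↦ SchwartzTensor.TChar.unique hT' hT, fun A B hA hB ↦ ?_,
    fun A B hA hB ↦ ?_⟩
  · exact SchwartzTensor.TChar.unique hT (SchwartzTensor.tChar_comp_left_right hA hB)
  · exact SchwartzTensor.TChar.unique hT (SchwartzTensor.tChar_comp_right_left hA hB)
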